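/- Let g be a weight function and η, ζ real numbers. With p = 2 (so ρ_{2,0} = 1 and ρ_{2,1} = −1/2), one has μ̄₄(g, g; η, ζ) = 4 ∫₀¹ ( η² ∫_s¹ g(u) g(u−s) du + ζ² ∫_s¹ g'(u) g'(u−s) du )² ds. -/

import Mathlib

open MeasureTheory ProbabilityTheory Finset

/-- A *weight function* `g` with (a.e.) derivative `g'`: `g` is continuous, vanishes outside
`[0,1]`, satisfies `g 0 = g 1 = 0`, and is piecewise `C¹` with a piecewise Lipschitz
derivative `g'`. -/
def IsWeight (g g' : ℝ → ℝ) : Prop :=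
  Continuous g ∧ (∀ x, x ∉ Set.Icc (0 : ℝ) 1 → g x = 0) ∧ g 0 = 0 ∧ g 1 = 0 ∧
  (∀ x, x ∉ Set.Icc (0 : ℝ) 1 → g' x = 0) ∧
  ∃ (r : ℕ) (t : ℕ → ℝ) (L : NNReal), 0 < r ∧ t 0 = 0 ∧ t r = 1 ∧
    (∀ i < r, t i < t (i + 1)) ∧
    ∀ i < r, (∀ x ∈ Set.Ioo (t i) (t (i + 1)), HasDerivAt g (g' x) x) ∧
      LipschitzOnWith L g' (Set.Ioo (t i) (t (i + 1)))

/-- The `4 × 4` covariance matrix `Σ_g(t)` (the case `h = g` of `Σ_{g,h}(t)`). -/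
noncomputable def covMat (g gd : ℝ → ℝ) (t : ℝ) : Matrix (Fin 4) (Fin 4) ℝ :=
  !![(∫ s in (0 : ℝ)..1, g s ^ 2), 0, (∫ s : ℝ, g (s - 1) * g (s - t)), 0;
     0, (∫ s in (0 : ℝ)..1, gd s ^ 2), 0, (∫ s : ℝ, gd (s - 1) * gd (s - t));
     (∫ s : ℝ, g (s - 1) * g (s - t)), 0, (∫ s in (0 : ℝ)..1, g s ^ 2), 0;
     0, (∫ s : ℝ, gd (s - 1) * gd (s - t)), 0, (∫ s in (0 : ℝ)..1, gd s ^ 2)]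

/-- `ν` is a centered Gaussian probability distribution on `ℝ⁴` with covariance matrix `S`. -/
def IsCenteredGaussianCov (ν : Measure (Fin 4 → ℝ)) (S : Matrix (Fin 4) (Fin 4) ℝ) : Prop :=
  ∀ c : Fin 4 → ℝ,
    ν.map (fun x => ∑ i, c i * x i) =
      gaussianReal 0 (∑ i, ∑ j, c i * S i j * c j).toNNReal

/-- `m₂(g; η, ζ) = E[(η X + ζ Y)²]` for `X, Y` independent centered Gaussians with variances
`∫₀¹ g²` and `∫₀¹ (g')²`. -/
noncomputable def mOne2 (g gd : ℝ → ℝ) (η ζ : ℝ) : ℝ :=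
  ∫ x : ℝ × ℝ, (η * x.1 + ζ * x.2) ^ 2
    ∂((gaussianReal 0 (∫ s in (0 : ℝ)..1, g s ^ 2).toNNReal).prod
        (gaussianReal 0 (∫ s in (0 : ℝ)..1, gd s ^ 2).toNNReal))


lemma gauss_int_pow (v : NNReal) (n : ℕ) : Integrable (fun x : ℝ => x ^ n) (gaussianReal 0 v) := by
  have h := (memLp_id_gaussianReal (μ := 0) (v := v) (n : NNReal))
  rcases Nat.eq_zero_or_pos n with rfl | hn
  · simp
  · have h2 := MemLp.integrable_norm_pow (p := n) (by simpa using h) hn.ne'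
    refine (integrable_norm_iff (by fun_prop)).1 ?_
    simpa using h2

lemma gauss_m1 (v : NNReal) : ∫ x : ℝ, x ∂(gaussianReal 0 v) = 0 := by
  simp

lemma gauss_m2 (v : NNReal) : ∫ x : ℝ, x ^ 2 ∂(gaussianReal 0 v) = v := by
  have h := variance_fun_id_gaussianReal (μ := 0) (v := v)
  rw [variance_eq_integral measurable_id'.aemeasurable] at h
  simpa using h

lemma gauss_m4 (v : NNReal) : ∫ x : ℝ, x ^ 4 ∂(gaussianReal 0 v) = 3 * (v : ℝ) ^ 2 := by
  have h0 : ∫ x : ℝ, x ^ 4 ∂(gaussianReal 0 v)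
      = iteratedDeriv 4 (mgf (fun x ↦ x) (gaussianReal 0 v)) 0 := by
    rw [iteratedDeriv_mgf_zero] <;> simp
  rw [h0]
  set w : ℝ := (v : ℝ)
  have hm : mgf (fun x ↦ x) (gaussianReal 0 v) = fun t => Real.exp (w * t ^ 2 / 2) := by
    ext t
    rw [mgf_gaussianReal (μ := 0) (v := v) (by simp)]
    simp [w]
  rw [hm]
  have he : ∀ t : ℝ, HasDerivAt (fun t => Real.exp (w * t ^ 2 / 2))
      (Real.exp (w * t ^ 2 / 2) * (w * t)) t := by
    intro t
    have : HasDerivAt (fun t : ℝ => w * t ^ 2 / 2) (w * t) t := by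
      have := ((hasDerivAt_pow 2 t).const_mul w).div_const 2
      refine this.congr_deriv ?_
      norm_num; ring
    exact this.exp
  have key : ∀ (p p' : ℝ → ℝ), (∀ t, HasDerivAt p (p' t) t) →
      deriv (fun t => Real.exp (w * t ^ 2 / 2) * p t)
       = fun t => Real.exp (w * t ^ 2 / 2) * (w * t * p t + p' t) := by
    intro p p' hp
    ext t
    refine (((he t).mul (hp t)).congr_deriv ?_).deriv
    ring
  have e1 : deriv (fun t => Real.exp (w * t ^ 2 / 2))
       = fun t => Real.exp (w * t ^ 2 / 2) * (w * t) := by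
    ext t; exact (he t).deriv
  have q1 : ∀ t : ℝ, HasDerivAt (fun t => w * t) w t := fun t => by
    simpa using (hasDerivAt_id t).const_mul w
  have q2 : ∀ t : ℝ, HasDerivAt (fun t => w * t * (w * t) + w) (w * (w * t) + w * t * w) t :=
    fun t => ((q1 t).mul (q1 t)).add_const w
  have q3 : ∀ t : ℝ, HasDerivAt
      (fun t => w * t * (w * t * (w * t) + w) + (w * (w * t) + w * t * w))
      (w * (w * t * (w * t) + w) + w * t * (w * (w * t) + w * t * w) + (w * w + w * w)) t :=
    fun t => ((q1 t).mul (q2 t)).add (((q1 t).const_mul w).add ((q1 t).mul_const w))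
  simp only [iteratedDeriv_succ, iteratedDeriv_zero]
  rw [e1, key _ _ q1, key _ _ q2, key _ _ q3]
  simp
  ring

lemma mOne2_eq (g gd : ℝ → ℝ) (η ζ : ℝ) : mOne2 g gd η ζ =
    η ^ 2 * (∫ s in (0 : ℝ)..1, g s ^ 2) + ζ ^ 2 * (∫ s in (0 : ℝ)..1, gd s ^ 2) := by
  have hA : 0 ≤ ∫ s in (0 : ℝ)..1, g s ^ 2 :=
    intervalIntegral.integral_nonneg zero_le_one fun _ _ => sq_nonneg _
  have hB : 0 ≤ ∫ s in (0 : ℝ)..1, gd s ^ 2 :=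
    intervalIntegral.integral_nonneg zero_le_one fun _ _ => sq_nonneg _
  unfold mOne2
  set A := ∫ s in (0 : ℝ)..1, g s ^ 2
  set B := ∫ s in (0 : ℝ)..1, gd s ^ 2
  set P := gaussianReal 0 A.toNNReal
  set Q := gaussianReal 0 B.toNNReal
  have i1 : Integrable (fun z : ℝ × ℝ => z.1 ^ 2 * 1) (P.prod Q) :=
    (gauss_int_pow _ 2).mul_prod (integrable_const (1:ℝ))
  have i2 : Integrable (fun z : ℝ × ℝ => 1 * z.2 ^ 2) (P.prod Q) :=
    (integrable_const (1:ℝ)).mul_prod (gauss_int_pow _ 2)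
  have i3 : Integrable (fun z : ℝ × ℝ => z.1 * z.2) (P.prod Q) := by
    have := (gauss_int_pow A.toNNReal 1).mul_prod (gauss_int_pow B.toNNReal 1)
    simpa using this
  have e : (fun x : ℝ × ℝ => (η * x.1 + ζ * x.2) ^ 2) = fun x =>
      η ^ 2 * (x.1 ^ 2 * 1) + 2 * η * ζ * (x.1 * x.2) + ζ ^ 2 * (1 * x.2 ^ 2) := by
    ext x; ring
  rw [e, integral_add (by exact (i1.const_mul _).add (i3.const_mul _)) (i2.const_mul _),
    integral_add (i1.const_mul _) (i3.const_mul _), integral_const_mul, integral_const_mul,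
    integral_const_mul, integral_prod_mul (fun x : ℝ => x ^ 2) (fun _ : ℝ => (1:ℝ)),
    integral_prod_mul (fun _ : ℝ => (1:ℝ)) (fun x : ℝ => x ^ 2),
    integral_prod_mul (fun x : ℝ => x) (fun x : ℝ => x), gauss_m2, gauss_m2, gauss_m1]
  simp [hA, hB]

lemma law_pow {Ω : Type*} [MeasurableSpace Ω] (P : Measure Ω) (U : Ω → ℝ) (hU : Measurable U)
    (v : NNReal) (h : P.map U = gaussianReal 0 v) :
    (∀ n, Integrable (fun x => U x ^ n) P) ∧ ∫ x, U x ^ 2 ∂P = v ∧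
      ∫ x, U x ^ 4 ∂P = 3 * (v : ℝ) ^ 2 := by
  refine ⟨fun n => ?_, ?_, ?_⟩
  · have := gauss_int_pow v n
    rw [← h] at this
    exact (integrable_map_measure (g := fun y : ℝ => y ^ n)
      (by fun_prop) hU.aemeasurable).1 this
  · rw [← gauss_m2, ← h, integral_map hU.aemeasurable (by fun_prop)]
  · rw [← gauss_m4, ← h, integral_map hU.aemeasurable (by fun_prop)]

lemma gauss_pair {Ω : Type*} [MeasurableSpace Ω] (P : Measure Ω) (U V : Ω → ℝ)
    (hU : Measurable U) (hV : Measurable V) (σ c : ℝ) (hσ : 0 ≤ σ)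
    (h1 : P.map U = gaussianReal 0 σ.toNNReal) (h2 : P.map V = gaussianReal 0 σ.toNNReal)
    (h3 : P.map (fun x => U x + V x) = gaussianReal 0 (2 * σ + 2 * c).toNNReal)
    (h4 : P.map (fun x => U x - V x) = gaussianReal 0 (2 * σ - 2 * c).toNNReal) :
    |c| ≤ σ ∧ ∫ x, U x ^ 2 ∂P = σ ∧ ∫ x, V x ^ 2 ∂P = σ ∧
      ∫ x, U x ^ 2 * V x ^ 2 ∂P = σ ^ 2 + 2 * c ^ 2 := by
  obtain ⟨a1, b1, c1⟩ := law_pow P U hU _ h1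
  obtain ⟨a2, b2, c2⟩ := law_pow P V hV _ h2
  obtain ⟨a3, b3, c3⟩ := law_pow P (fun x => U x + V x) (hU.add hV) _ h3
  obtain ⟨a4, b4, c4⟩ := law_pow P (fun x => U x - V x) (hU.sub hV) _ h4
  rw [Real.coe_toNNReal _ hσ] at b1 b2 c1 c2
  rw [Real.coe_toNNReal'] at b3 b4 c3 c4
  have s : ∫ x, (U x + V x) ^ 2 ∂P + ∫ x, (U x - V x) ^ 2 ∂P
      = 2 * ∫ x, U x ^ 2 ∂P + 2 * ∫ x, V x ^ 2 ∂P := by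
    rw [← integral_add (a3 2) (a4 2), ← integral_const_mul, ← integral_const_mul,
      ← integral_add ((a1 2).const_mul _) ((a2 2).const_mul _)]
    congr 1; ext x; ring
  rw [b1, b2, b3, b4] at s
  have hc : |c| ≤ σ := by
    rw [abs_le]
    rcases max_cases (2 * σ + 2 * c) 0 with h | h <;>
    rcases max_cases (2 * σ - 2 * c) 0 with h' | h' <;> constructor <;> linarith
  have hc' := abs_le.1 hc
  rw [max_eq_left (by linarith)] at c3 c4
  refine ⟨hc, b1, b2, ?_⟩
  have e : (fun x => U x ^ 2 * V x ^ 2) = fun x =>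
      (1 / 12) * (((U x + V x) ^ 4 + (U x - V x) ^ 4) - (2 * U x ^ 4 + 2 * V x ^ 4)) := by
    ext x; ring
  rw [e, integral_const_mul, integral_sub (by exact (a3 4).add (a4 4))
    (by exact ((a1 4).const_mul _).add ((a2 4).const_mul _)),
    integral_add (a3 4) (a4 4), integral_add ((a1 4).const_mul _) ((a2 4).const_mul _),
    integral_const_mul, integral_const_mul, c1, c2, c3, c4]
  ring

lemma exists_piece (t : ℕ → ℝ) (x : ℝ) (k : ℕ) (h0 : t 0 < x) (hk : x < t k)
    (hx : ∀ i, x ≠ t i) : ∃ i < k, x ∈ Set.Ioo (t i) (t (i + 1)) := by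
  induction k with
  | zero => exact absurd h0 (not_lt.2 hk.le)
  | succ k ih =>
    rcases lt_or_gt_of_ne (hx k) with h | h
    · obtain ⟨i, hi, h⟩ := ih h
      exact ⟨i, by omega, h⟩
    · exact ⟨k, by omega, h, hk⟩

lemma weight_ae (g gd : ℝ → ℝ) (hg : IsWeight g gd) : gd =ᵐ[volume] deriv g := by
  obtain ⟨hc, hz, h0, h1, hz', r, t, L, hr, t0, tr, ht, hd⟩ := hg
  have hco : (Set.range t).Countable := Set.countable_range t
  filter_upwards [hco.ae_notMem volume] with x hx
  have hx' : ∀ i, x ≠ t i := fun i h => hx ⟨i, h.symm⟩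
  by_cases hI : x ∈ Set.Icc (0:ℝ) 1
  · have h0x : t 0 < x := lt_of_le_of_ne (t0 ▸ hI.1) (hx' 0).symm
    have hxr : x < t r := lt_of_le_of_ne (tr ▸ hI.2) (hx' r)
    obtain ⟨i, hi, h⟩ := exists_piece t x r h0x hxr hx'
    exact (((hd i hi).1 x h).deriv).symm
  · rw [hz' x hI]
    have : g =ᶠ[nhds x] fun _ => 0 := by
      filter_upwards [isClosed_Icc.isOpen_compl.mem_nhds hI] with y hy using hz y hy
    rw [this.deriv_eq]; simp

/-- autocorrelation -/
noncomputable def acorr (f : ℝ → ℝ) (s : ℝ) : ℝ := ∫ u : ℝ, f u * f (u - s)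

lemma acorr_shift (f : ℝ → ℝ) (t : ℝ) : (∫ s : ℝ, f (s - 1) * f (s - t)) = acorr f (t - 1) := by
  unfold acorr
  rw [← integral_sub_right_eq_self (fun u => f u * f (u - (t - 1))) 1]
  congr 1; ext s; congr 2; ring

lemma acorr_neg (f : ℝ → ℝ) (s : ℝ) : acorr f (-s) = acorr f s := by
  unfold acorr
  rw [← integral_sub_right_eq_self (fun u => f u * f (u - (-s))) s]
  congr 1; ext u; rw [mul_comm]; congr 2; ring

lemma acorr_meas (f h : ℝ → ℝ) (hf : f =ᵐ[volume] h) (hm : Measurable h) :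
    Measurable (acorr f) := by
  have e : acorr f = fun s => ∫ u : ℝ, h u * h (u - s) := by
    ext s
    refine integral_congr_ae ?_
    have h2 : (fun u => f (u - s)) =ᵐ[volume] fun u => h (u - s) :=
      (measurePreserving_sub_right volume s).quasiMeasurePreserving.ae_eq hf
    exact hf.mul h2
  rw [e]
  have : StronglyMeasurable (Function.uncurry fun (s u : ℝ) => h u * h (u - s)) :=
    Measurable.stronglyMeasurable (by
      unfold Function.uncurry
      exact (hm.comp measurable_snd).mul (hm.comp (measurable_snd.sub measurable_fst)))
  exact this.integral_prod_right.measurable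

lemma acorr_Icc (f : ℝ → ℝ) (hz : ∀ x, x ∉ Set.Icc (0 : ℝ) 1 → f x = 0) (s : ℝ)
    (hs : s ∈ Set.Icc (0:ℝ) 1) : acorr f s = ∫ u in s..1, f u * f (u - s) := by
  rw [intervalIntegral.integral_of_le hs.2, ← integral_Icc_eq_integral_Ioc,
    setIntegral_eq_integral_of_forall_compl_eq_zero]
  · rfl
  · intro x hx
    by_cases h : x ∈ Set.Icc (0:ℝ) 1
    · rw [hz (x - s), mul_zero]
      intro h'
      exact hx ⟨by linarith [h'.1], h.2⟩
    · rw [hz x h, zero_mul]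

/-- formula (VQ3) in Theorem 4.6 of Jacod–Podolskij–Vetter. For a weight
function `g` and reals `η, ζ`, with `p = 2` (so `ρ_{2,0} = 1`, `ρ_{2,1} = -1/2`),
`μ̄₄(g,g;η,ζ) = 4 ∫₀¹ (η² ∫ₛ¹ g(u) g(u-s) du + ζ² ∫ₛ¹ g'(u) g'(u-s) du)² ds`. -/
theorem stmt16 (g gd : ℝ → ℝ) (hg : IsWeight g gd) (η ζ : ℝ)
    (ν : ℝ → Measure (Fin 4 → ℝ))
    (hν : ∀ t ∈ Set.Icc (0 : ℝ) 2, IsProbabilityMeasure (ν t) ∧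
      IsCenteredGaussianCov (ν t) (covMat g gd t)) :
    (∑ r ∈ range 2, ∑ r' ∈ range 2,
        (if r = 0 then (1 : ℝ) else -(1 / 2)) * (if r' = 0 then (1 : ℝ) else -(1 / 2)) *
          (2 * ζ ^ 2 * ∫ s in (0 : ℝ)..1, gd s ^ 2) ^ (r + r') *
          ∫ t in (0 : ℝ)..2,
            ∫ x, (η * x 0 + ζ * x 1) ^ (2 - 2 * r) * (η * x 2 + ζ * x 3) ^ (2 - 2 * r')
              ∂(ν t)) -
      2 * (mOne2 g gd η ζ - (1 / 2) * (2 * ζ ^ 2 * ∫ s in (0 : ℝ)..1, gd s ^ 2)) ^ 2 =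
    4 * ∫ s in (0 : ℝ)..1,
        (η ^ 2 * (∫ u in s..1, g u * g (u - s)) +
          ζ ^ 2 * ∫ u in s..1, gd u * gd (u - s)) ^ 2 := by
  have hA : 0 ≤ ∫ s in (0 : ℝ)..1, g s ^ 2 :=
    intervalIntegral.integral_nonneg zero_le_one fun _ _ => sq_nonneg _
  have hB : 0 ≤ ∫ s in (0 : ℝ)..1, gd s ^ 2 :=
    intervalIntegral.integral_nonneg zero_le_one fun _ _ => sq_nonneg _
  rw [mOne2_eq]
  let F : ℝ → ℝ := fun s => η ^ 2 * acorr g s + ζ ^ 2 * acorr gd s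
  have hFm : Measurable F :=
    ((acorr_meas g g (by rfl) hg.1.measurable).const_mul _).add
      ((acorr_meas gd _ (weight_ae g gd hg) (measurable_deriv g)).const_mul _)
  have hFn : ∀ s, F (-s) = F s := fun s => by simp only [F, acorr_neg]
  have hR : (∫ s in (0 : ℝ)..1, (η ^ 2 * (∫ u in s..1, g u * g (u - s)) +
          ζ ^ 2 * ∫ u in s..1, gd u * gd (u - s)) ^ 2) = ∫ s in (0:ℝ)..1, F s ^ 2 := by
    refine intervalIntegral.integral_congr fun s hs => ?_
    rw [Set.uIcc_of_le zero_le_one] at hs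
    simp only [F]
    rw [acorr_Icc g hg.2.1 s hs, acorr_Icc gd hg.2.2.2.2.1 s hs]
  rw [hR]
  have hcov : ∀ t, covMat g gd t = 
    !![(∫ s in (0 : ℝ)..1, g s ^ 2), 0, acorr g (t - 1), 0;
     0, (∫ s in (0 : ℝ)..1, gd s ^ 2), 0, acorr gd (t - 1);
     acorr g (t - 1), 0, (∫ s in (0 : ℝ)..1, g s ^ 2), 0;
     0, acorr gd (t - 1), 0, (∫ s in (0 : ℝ)..1, gd s ^ 2)] := by
    intro t
    unfold covMat
    rw [acorr_shift, acorr_shift]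
  set A := ∫ s in (0 : ℝ)..1, g s ^ 2
  set B := ∫ s in (0 : ℝ)..1, gd s ^ 2
  set σ := η ^ 2 * A + ζ ^ 2 * B with hσdef
  have hσ : 0 ≤ σ := by positivity
  have hp : ∀ t ∈ Set.Icc (0:ℝ) 2, |F (t - 1)| ≤ σ ∧
      ∫ x, (η * x 0 + ζ * x 1) ^ 2 ∂(ν t) = σ ∧ ∫ x, (η * x 2 + ζ * x 3) ^ 2 ∂(ν t) = σ ∧
      ∫ x, (η * x 0 + ζ * x 1) ^ 2 * (η * x 2 + ζ * x 3) ^ 2 ∂(ν t)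
        = σ ^ 2 + 2 * F (t - 1) ^ 2 := by
    intro t ht
    obtain ⟨_, hG⟩ := hν t ht
    rw [hcov] at hG
    refine gauss_pair (ν t) (fun x => η * x 0 + ζ * x 1) (fun x => η * x 2 + ζ * x 3)
      (by fun_prop) (by fun_prop) σ _ hσ ?_ ?_ ?_ ?_
    · convert hG ![η, ζ, 0, 0] using 2
      · ext x; simp [Fin.sum_univ_four]
      · congr 1; simp [Fin.sum_univ_four, σ]; ring
    · convert hG ![0, 0, η, ζ] using 2
      · ext x; simp [Fin.sum_univ_four]
      · congr 1; simp [Fin.sum_univ_four, σ]; ring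
    · convert hG ![η, ζ, η, ζ] using 2
      · ext x; simp [Fin.sum_univ_four]; ring
      · congr 1; simp [Fin.sum_univ_four, σ, F]; ring
    · convert hG ![η, ζ, -η, -ζ] using 2
      · ext x; simp [Fin.sum_univ_four]; ring
      · congr 1; simp [Fin.sum_univ_four, σ, F]; ring
  have hFb : ∀ s ∈ Set.Icc (-1:ℝ) 1, |F s| ≤ σ := by
    intro s hs
    have := (hp (s + 1) ⟨by linarith [hs.1], by linarith [hs.2]⟩).1
    simpa using this
  have hint : ∀ a b : ℝ, a ∈ Set.Icc (-1:ℝ) 1 → b ∈ Set.Icc (-1:ℝ) 1 → a ≤ b →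
      IntervalIntegrable (fun s => F s ^ 2) volume a b := by
    intro a b ha hb hab
    rw [intervalIntegrable_iff_integrableOn_Ioc_of_le hab]
    refine Measure.integrableOn_of_bounded (M := σ ^ 2) (by simp) (by fun_prop) ?_
    filter_upwards [ae_restrict_mem measurableSet_Ioc] with x hx
    have := hFb x ⟨by linarith [ha.1, hx.1], by linarith [hb.2, hx.2]⟩
    rw [Real.norm_eq_abs, abs_pow]
    gcongr
  have hI2 : ∫ t in (0:ℝ)..2, F (t - 1) ^ 2 = 2 * ∫ s in (0:ℝ)..1, F s ^ 2 := by
    rw [intervalIntegral.integral_comp_sub_right (fun s => F s ^ 2) 1]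
    norm_num
    rw [← intervalIntegral.integral_add_adjacent_intervals (hint (-1) 0 (by simp) (by simp) (by simp))
      (hint 0 1 (by simp) (by simp) (by simp))]
    have : ∫ s in (-1:ℝ)..0, F s ^ 2 = ∫ s in (0:ℝ)..1, F s ^ 2 := by
      have := intervalIntegral.integral_comp_neg (a := 0) (b := 1) (fun s => F s ^ 2)
      simp only [hFn, neg_zero] at this
      exact this.symm
    rw [this]; ring
  have hII : IntervalIntegrable (fun t => F (t - 1) ^ 2) volume 0 2 := by
    have := (hint (-1) 1 (by simp) (by simp) (by simp)).comp_sub_right 1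
    norm_num at this
    exact this
  have u02 : Set.uIcc (0:ℝ) 2 = Set.Icc 0 2 := Set.uIcc_of_le (by norm_num)
  have k00 : ∫ t in (0:ℝ)..2, ∫ x, (η * x 0 + ζ * x 1) ^ 2 * (η * x 2 + ζ * x 3) ^ 2 ∂(ν t)
      = 2 * σ ^ 2 + 4 * ∫ s in (0:ℝ)..1, F s ^ 2 := by
    rw [intervalIntegral.integral_congr (g := fun t => σ ^ 2 + 2 * F (t - 1) ^ 2)
      (fun t ht => (hp t (u02 ▸ ht)).2.2.2),
      intervalIntegral.integral_add (by simp) (hII.const_mul 2),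
      intervalIntegral.integral_const_mul, hI2]
    simp; ring
  have k10 : ∫ t in (0:ℝ)..2, ∫ x, (η * x 0 + ζ * x 1) ^ 2 ∂(ν t) = 2 * σ := by
    rw [intervalIntegral.integral_congr (g := fun t => σ)
      (fun t ht => (hp t (u02 ▸ ht)).2.1)]
    simp
  have k01 : ∫ t in (0:ℝ)..2, ∫ x, (η * x 2 + ζ * x 3) ^ 2 ∂(ν t) = 2 * σ := by
    rw [intervalIntegral.integral_congr (g := fun t => σ)
      (fun t ht => (hp t (u02 ▸ ht)).2.2.1)]
    simp
  have k11 : ∫ t in (0:ℝ)..2, ∫ x, (1:ℝ) ∂(ν t) = 2 := by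
    rw [intervalIntegral.integral_congr (g := fun t => (1:ℝ))
      (fun t ht => by
        have := (hν t (u02 ▸ ht)).1
        simp)]
    simp
  simp only [Finset.sum_range_succ, Finset.sum_range_zero, Nat.mul_zero, Nat.sub_zero,
    Nat.sub_self, pow_zero, mul_one, one_mul, if_true, one_ne_zero, if_false, k00, k10, k01, k11]
  ring
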